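/- Let G = (V,E) be a finite simple graph, s ∉ V a new vertex, and G_s the graph on V ∪ {s} with edge set E ∪ {sv : v ∈ V}. For any V' ⊆ V, the induced subgraph G[V'] is a forest if and only if there exists an edge set Z with E(G[V']) ⊆ Z ⊆ E(G[V']) ∪ {sv : v ∈ V'} such that the graph with vertex set V' ∪ {s} and edge set Z is a tree; moreover, any such tree has exactly |V'| edges. -/

import Mathlib

/-- The edges of the induced subgraph `G[V']`, viewed inside `Option V`
(where `none` plays the role of the dummy vertex `s`). -/
def inducedEdges {V : Type*} (G : SimpleGraph V) (V' : Set V) :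
    Set (Sym2 (Option V)) :=
  {e | ∃ u v : V, u ∈ V' ∧ v ∈ V' ∧ G.Adj u v ∧ e = s(some u, some v)}

/-- The edges `{sv : v ∈ V'}` joining the dummy vertex `s = none` to the
vertices of `V'`. -/
def dummyEdges {V : Type*} (V' : Set V) : Set (Sym2 (Option V)) :=
  {e | ∃ v ∈ V', e = s((none : Option V), some v)}

open SimpleGraph in
lemma aux_acyclic {V : Type*} (G : SimpleGraph V) (V' : Set V) (h : (G.induce V').IsAcyclic) :
    ((SimpleGraph.fromEdgeSet (inducedEdges G V')).induce
      (insert (none : Option V) (some '' V'))).IsAcyclic := by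
  classical
  have key : ∀ x y : Option V, (SimpleGraph.fromEdgeSet (inducedEdges G V')).Adj x y →
      ∃ a b : V, x = some a ∧ y = some b ∧ a ∈ V' ∧ b ∈ V' ∧ G.Adj a b := by
    rintro x y hxy
    rw [fromEdgeSet_adj] at hxy
    obtain ⟨⟨u, v, hu, hv, huv, he⟩, -⟩ := hxy
    rcases Sym2.eq_iff.1 he with ⟨rfl, rfl⟩ | ⟨rfl, rfl⟩
    · exact ⟨u, v, rfl, rfl, hu, hv, huv⟩
    · exact ⟨v, u, rfl, rfl, hv, hu, huv.symm⟩
  rw [isAcyclic_iff_forall_adj_isBridge] at h ⊢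
  rintro ⟨x, hx⟩ ⟨y, hy⟩ hxy
  obtain ⟨a, b, rfl, rfl, ha, hb, hab⟩ := key _ _ hxy
  have hbr := @h ⟨a, ha⟩ ⟨b, hb⟩ hab
  rw [isBridge_iff] at hbr ⊢
  intro hr
  apply hbr
  let f : (insert (none : Option V) (some '' V') : Set (Option V)) → V' := fun z =>
    if hz : ∃ c : V', z.1 = some c.1 then hz.choose else ⟨a, ha⟩
  have hf : ∀ c (hc : c ∈ V') (hc'), f ⟨some c, hc'⟩ = ⟨c, hc⟩ := by
    intro c hc hc'
    have hz : ∃ d : V', (some c : Option V) = some d.1 := ⟨⟨c, hc⟩, rfl⟩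
    have : f ⟨some c, hc'⟩ = hz.choose := dif_pos hz
    rw [this]
    exact Subtype.ext (Option.some.inj hz.choose_spec).symm
  have := hr.map (G' := (G.induce V').deleteEdges {s(⟨a, ha⟩, ⟨b, hb⟩)}) ⟨f, ?_⟩
  · have h3 : ((G.induce V').deleteEdges {s(⟨a, ha⟩, ⟨b, hb⟩)}).Reachable
        (f ⟨some a, hx⟩) (f ⟨some b, hy⟩) := this
    rwa [hf a ha hx, hf b hb hy] at h3
  · rintro ⟨p, hp⟩ ⟨q, hq⟩ hpq
    rw [deleteEdges_adj] at hpq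
    obtain ⟨hpq, hne⟩ := hpq
    obtain ⟨c, d, rfl, rfl, hc, hd, hcd⟩ := key _ _ hpq
    rw [hf c hc, hf d hd, deleteEdges_adj]
    refine ⟨hcd, ?_⟩
    simpa [Sym2.eq_iff, Subtype.ext_iff] using hne

open SimpleGraph in
lemma aux_edges {V : Type*} (G : SimpleGraph V) (V' : Set V) (Z : Set (Sym2 (Option V)))
    (hZ : Z ⊆ inducedEdges G V' ∪ dummyEdges V') :
    Z = Sym2.map Subtype.val '' ((SimpleGraph.fromEdgeSet Z).induce
          (insert (none : Option V) (some '' V'))).edgeSet := by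
  ext e
  constructor
  · intro he
    rcases hZ he with ⟨u, v, hu, hv, huv, rfl⟩ | ⟨v, hv, rfl⟩
    · refine ⟨s(⟨some u, by simp [hu]⟩, ⟨some v, by simp [hv]⟩), ?_, rfl⟩
      simp [he, huv.ne]
    · refine ⟨s(⟨none, by simp⟩, ⟨some v, by simp [hv]⟩), ?_, rfl⟩
      simp [he]
  · rintro ⟨e, he, rfl⟩
    induction e with
    | _ x y =>
      simp at he
      exact he.1

open SimpleGraph in
lemma aux_conn {V : Type*} (G : SimpleGraph V) (V' : Set V) :
    ((SimpleGraph.fromEdgeSet (inducedEdges G V' ∪ dummyEdges V')).induce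
      (insert (none : Option V) (some '' V'))).Connected := by
  rw [connected_iff_exists_forall_reachable]
  refine ⟨⟨none, by simp⟩, ?_⟩
  rintro ⟨w, rfl | ⟨v, hv, rfl⟩⟩
  · exact Reachable.refl _
  · apply Adj.reachable
    simp only [comap_adj, fromEdgeSet_adj, Function.Embedding.subtype_apply]
    exact ⟨Or.inr ⟨v, hv, rfl⟩, by simp⟩

/-- Correctness of the TCYC transformation: `V'` induces a forest in `G` iff
there is an edge set `Z` with `E(G[V']) ⊆ Z ⊆ E(G[V']) ∪ {sv : v ∈ V'}` such
that the graph on vertex set `V' ∪ {s}` with edge set `Z` is a tree; moreover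
any such tree has exactly `|V'|` edges. -/
theorem induced_forest_iff_tree_with_dummy {V : Type*} [Fintype V]
    (G : SimpleGraph V) (V' : Set V) :
    ((G.induce V').IsAcyclic ↔
      ∃ Z : Set (Sym2 (Option V)),
        inducedEdges G V' ⊆ Z ∧ Z ⊆ inducedEdges G V' ∪ dummyEdges V' ∧
        ((SimpleGraph.fromEdgeSet Z).induce
          (insert (none : Option V) (some '' V'))).IsTree) ∧
    (∀ Z : Set (Sym2 (Option V)),
        inducedEdges G V' ⊆ Z → Z ⊆ inducedEdges G V' ∪ dummyEdges V' →
        ((SimpleGraph.fromEdgeSet Z).induce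
          (insert (none : Option V) (some '' V'))).IsTree →
        Z.ncard = V'.ncard) := by
  classical
  refine ⟨⟨fun h => ?_, ?_⟩, ?_⟩
  · obtain ⟨T, hT1, hT2, hT⟩ := (aux_conn G V').exists_isTree_le_of_le_of_isAcyclic
      (H := (SimpleGraph.fromEdgeSet (inducedEdges G V')).induce
        (insert (none : Option V) (some '' V')))
      (by
        intro x y hxy
        simp only [SimpleGraph.comap_adj, SimpleGraph.fromEdgeSet_adj] at hxy ⊢
        exact ⟨Or.inl hxy.1, hxy.2⟩) (aux_acyclic G V' h)
    refine ⟨Sym2.map Subtype.val '' T.edgeSet, ?_, ?_, ?_⟩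
    · have := aux_edges G V' (inducedEdges G V') Set.subset_union_left
      rw [this]
      exact Set.image_mono (SimpleGraph.edgeSet_mono hT1)
    · have := aux_edges G V' (inducedEdges G V' ∪ dummyEdges V') subset_rfl
      rw [this]
      exact Set.image_mono (SimpleGraph.edgeSet_mono hT2)
    · convert hT
      ext x y
      have hinj := Sym2.map.injective (Subtype.val_injective
        (p := fun z => z ∈ insert (none : Option V) (some '' V')))
      have h2 : s(x.1, y.1) ∈ Sym2.map Subtype.val '' T.edgeSet ↔ s(x, y) ∈ T.edgeSet :=
        hinj.mem_set_image (a := s(x, y))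
      simp only [SimpleGraph.comap_adj, SimpleGraph.fromEdgeSet_adj,
        Function.Embedding.subtype_apply]
      rw [h2, SimpleGraph.mem_edgeSet]
      exact ⟨fun h => h.1, fun h => ⟨h, fun e => h.ne (Subtype.ext e)⟩⟩
  · rintro ⟨Z, hZ1, hZ2, hT⟩
    refine hT.isAcyclic.comap ⟨fun v => ⟨some v.1, by simp⟩, ?_⟩ ?_
    · rintro ⟨a, ha⟩ ⟨b, hb⟩ hab
      have hab' : G.Adj a b := hab
      simp only [SimpleGraph.comap_adj, SimpleGraph.fromEdgeSet_adj,
        Function.Embedding.subtype_apply]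
      exact ⟨hZ1 ⟨a, b, ha, hb, hab', rfl⟩, by simpa using hab'.ne⟩
    · rintro ⟨a, ha⟩ ⟨b, hb⟩ hab
      simpa using hab
  · intro Z hZ1 hZ2 hT
    have h1 := (SimpleGraph.isTree_iff_connected_and_card.1 hT).2
    have h2 := aux_edges G V' Z hZ2
    have h3 : Z.ncard = _ := (congrArg Set.ncard h2).trans
      (Set.ncard_image_of_injective _ (Sym2.map.injective Subtype.val_injective))
    have h4 : (insert (none : Option V) (some '' V')).ncard = V'.ncard + 1 := by
      rw [Set.ncard_insert_of_notMem (by simp) (Set.toFinite _),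
        Set.ncard_image_of_injective _ (Option.some_injective V)]
    rw [Nat.card_coe_set_eq, Nat.card_coe_set_eq, h4] at h1
    omega
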